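/- arXiv:0908.3383 — 5 statements merged into one kernel-verified Lean document; each statement's English description precedes it below -/
import Mathlib

section
/- Let Ω > 0 and τ ∈ ℝ. Let F, G : ℝ → ℂ be integrable functions such that F(ξ) = 0 whenever |ξ| ≥ Ω, and G(ζ) = 0 whenever |ζ| < Ω. Define f(x) = ∫_ℝ F(ξ)·exp(2πi·ξ·x) dξ. Then for every x ∈ ℝ, ∫_ℝ exp(iπτ·sgn ω)·(∫_ℝ F(ξ)·G(ω−ξ) dξ)·exp(2πi·ω·x) dω = f(x) · ∫_ℝ exp(iπτ·sgn ζ)·G(ζ)·exp(2πi·ζ·x) dζ. (Generalized Bedrosian identity: the fractional Hilbert transform of the product of a lowpass and a highpass signal with non-overlapping spectra factors as the lowpass signal times the fractional Hilbert transform of the highpass signal.) -/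
open MeasureTheory Real Complex

theorem generalized_bedrosian
    (Ω τ : ℝ) (hΩ : 0 < Ω) (F G : ℝ → ℂ)
    (hF : Integrable F) (hG : Integrable G)
    (hFsupp : ∀ ξ : ℝ, Ω ≤ |ξ| → F ξ = 0)
    (hGsupp : ∀ ζ : ℝ, |ζ| < Ω → G ζ = 0)
    (f : ℝ → ℂ)
    (hf : ∀ x : ℝ, f x = ∫ ξ : ℝ, F ξ * Complex.exp (2 * (π : ℂ) * Complex.I * (ξ : ℂ) * (x : ℂ))) :
    ∀ x : ℝ,
      (∫ ω : ℝ, Complex.exp (Complex.I * (π : ℂ) * (τ : ℂ) * (Real.sign ω : ℂ)) *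
          (∫ ξ : ℝ, F ξ * G (ω - ξ)) *
          Complex.exp (2 * (π : ℂ) * Complex.I * (ω : ℂ) * (x : ℂ)))
        = f x *
          ∫ ζ : ℝ, Complex.exp (Complex.I * (π : ℂ) * (τ : ℂ) * (Real.sign ζ : ℂ)) *
            G ζ * Complex.exp (2 * (π : ℂ) * Complex.I * (ζ : ℂ) * (x : ℂ)) := by
  intro x
  have hsm : Measurable Real.sign := by
    have h : Real.sign = fun r : ℝ => if r < 0 then (-1 : ℝ) else if 0 < r then 1 else 0 := by
      funext r; rfl
    rw [h]
    exact Measurable.ite measurableSet_Iio measurable_const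
      (Measurable.ite measurableSet_Ioi measurable_const measurable_const)
  have hF' : Integrable (fun ξ : ℝ => F ξ *
      Complex.exp (2 * (π : ℂ) * Complex.I * (ξ : ℂ) * (x : ℂ))) := by
    refine hF.mono (hF.aestronglyMeasurable.mul (by fun_prop)) (Filter.Eventually.of_forall ?_)
    intro ξ
    simp [Complex.norm_exp]
  have hG' : Integrable (fun ζ : ℝ =>
      Complex.exp (Complex.I * (π : ℂ) * (τ : ℂ) * (Real.sign ζ : ℂ)) *
        G ζ * Complex.exp (2 * (π : ℂ) * Complex.I * (ζ : ℂ) * (x : ℂ))) := by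
    refine hG.mono (AEStronglyMeasurable.mul (AEStronglyMeasurable.mul
      (Measurable.aestronglyMeasurable (by fun_prop)) hG.aestronglyMeasurable) (by fun_prop))
      (Filter.Eventually.of_forall ?_)
    intro ξ
    simp [Complex.norm_exp]
  have key := integral_convolution (ContinuousLinearMap.mul ℝ ℂ) hF' hG'
  rw [hf x]
  simp only [ContinuousLinearMap.mul_apply'] at key
  rw [← key]
  congr 1
  funext ω
  simp only [convolution_def, ContinuousLinearMap.mul_apply']
  rw [← integral_const_mul, ← integral_mul_const]
  congr 1
  funext ξ
  by_cases h1 : Ω ≤ |ξ|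
  · simp [hFsupp ξ h1]
  by_cases h2 : |ω - ξ| < Ω
  · simp [hGsupp _ h2]
  have hs : Real.sign ω = Real.sign (ω - ξ) := by
    push Not at h1 h2
    obtain ⟨h3, h4⟩ := abs_lt.mp h1
    rcases le_abs.mp h2 with h | h
    · rw [Real.sign_of_pos (by linarith), Real.sign_of_pos (by linarith)]
    · rw [Real.sign_of_neg (by linarith), Real.sign_of_neg (by linarith)]
  have he : Complex.exp (2 * (π : ℂ) * Complex.I * (ω : ℂ) * (x : ℂ)) =
      Complex.exp (2 * (π : ℂ) * Complex.I * (ξ : ℂ) * (x : ℂ)) *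
      Complex.exp (2 * (π : ℂ) * Complex.I * ((ω - ξ : ℝ) : ℂ) * (x : ℂ)) := by
    rw [← Complex.exp_add]
    congr 1
    push_cast
    ring
  rw [hs, he]
  ring
end

section
/- Let f : ℝ → ℂ be integrable with integrable Fourier transform 𝓕f, let λ > 0 and τ ∈ ℝ, and let g(x) = f(λx). Then for every x ∈ ℝ, (𝓗_τ g)(x) = (𝓗_τ f)(λx). (Property (P2): the fractional Hilbert transform is invariant to dilations.) -/
open MeasureTheory Real Complex
open scoped FourierTransform

/-- Pointwise fractional Hilbert transform of order `τ`:
Fourier synthesis of the multiplier `exp(iπτ·sgn ω)` applied to the spectrum of `h`. -/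
noncomputable def fHT (τ : ℝ) (h : ℝ → ℂ) (x : ℝ) : ℂ :=
  ∫ ω : ℝ, Complex.exp (Complex.I * (π : ℂ) * (τ : ℂ) * (Real.sign ω : ℂ)) *
    (𝓕 h) ω * Complex.exp (2 * (π : ℂ) * Complex.I * (ω : ℂ) * (x : ℂ))

theorem fHT_dilation_invariance
    (f : ℝ → ℂ) (hf : Integrable f) (hFf : Integrable (𝓕 f))
    (l : ℝ) (hl : 0 < l) (τ : ℝ)
    (g : ℝ → ℂ) (hg : ∀ x : ℝ, g x = f (l * x)) :
    ∀ x : ℝ, fHT τ g x = fHT τ f (l * x) := by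
  intro x
  have hl0 : (l : ℂ) ≠ 0 := by exact_mod_cast hl.ne'
  have hF : ∀ w : ℝ, (𝓕 g) (l * w) = (l : ℂ)⁻¹ * (𝓕 f) w := by
    intro w
    rw [Real.fourier_real_eq_integral_exp_smul, Real.fourier_real_eq_integral_exp_smul]
    have h := Measure.integral_comp_mul_left
      (fun v : ℝ => Complex.exp (↑(-2 * π * v * w) * Complex.I) • f v) l
    rw [abs_of_pos (inv_pos.mpr hl), Complex.real_smul, Complex.ofReal_inv] at h
    rw [← h]
    refine integral_congr_ae (Filter.Eventually.of_forall fun v => ?_)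
    simp only [hg]
    congr 3
    push_cast
    ring
  have hs : ∀ w : ℝ, Real.sign (l * w) = Real.sign w := by
    intro w
    rcases lt_trichotomy w 0 with h | h | h
    · rw [Real.sign_of_neg h, Real.sign_of_neg (mul_neg_of_pos_of_neg hl h)]
    · simp [h]
    · rw [Real.sign_of_pos h, Real.sign_of_pos (mul_pos hl h)]
  unfold fHT
  have h := Measure.integral_comp_mul_left
    (fun ω : ℝ => Complex.exp (Complex.I * (π : ℂ) * (τ : ℂ) * (Real.sign ω : ℂ)) *
      (𝓕 g) ω * Complex.exp (2 * (π : ℂ) * Complex.I * (ω : ℂ) * (x : ℂ))) l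
  rw [abs_of_pos (inv_pos.mpr hl), Complex.real_smul, Complex.ofReal_inv] at h
  apply mul_left_cancel₀ (inv_ne_zero hl0)
  rw [← h, ← integral_const_mul]
  refine integral_congr_ae (Filter.Eventually.of_forall fun w => ?_)
  simp only [hs, hF]
  have e : 2 * (π : ℂ) * Complex.I * ((l * w : ℝ) : ℂ) * (x : ℂ)
      = 2 * (π : ℂ) * Complex.I * (w : ℂ) * ((l * x : ℝ) : ℂ) := by
    push_cast
    ring
  rw [e]
  ring
end

section
/- Let ω₀ > 0, τ ∈ ℝ, and let Φ : ℝ → ℂ be integrable with Φ(ω) = 0 whenever |ω| ≥ ω₀. Define the envelope φ(x) = ∫_ℝ Φ(ξ)·exp(2πi·ξ·x) dξ. Then for every x ∈ ℝ, ∫_ℝ exp(iπτ·sgn ω)·((Φ(ω − ω₀) + Φ(ω + ω₀))/2)·exp(2πi·ω·x) dω = φ(x)·cos(2π·ω₀·x + πτ). (The fractional Hilbert transform of a modulated lowpass function acts as a pure phase shift on the modulating sinusoid while preserving the lowpass envelope: 𝓗_τ{φ(x)·cos(2πω₀x)} = φ(x)·cos(2πω₀x + πτ).) -/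
open MeasureTheory Real Complex

theorem fHT_modulated_wavelet
    (ω₀ τ : ℝ) (hω₀ : 0 < ω₀)
    (Φ : ℝ → ℂ) (hΦ : Integrable Φ)
    (hsupp : ∀ ω : ℝ, ω₀ ≤ |ω| → Φ ω = 0)
    (φ : ℝ → ℂ)
    (hφ : ∀ x : ℝ, φ x = ∫ ξ : ℝ, Φ ξ * Complex.exp (2 * (π : ℂ) * Complex.I * (ξ : ℂ) * (x : ℂ))) :
    ∀ x : ℝ,
      (∫ ω : ℝ, Complex.exp (Complex.I * (π : ℂ) * (τ : ℂ) * (Real.sign ω : ℂ)) *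
          ((Φ (ω - ω₀) + Φ (ω + ω₀)) / 2) *
          Complex.exp (2 * (π : ℂ) * Complex.I * (ω : ℂ) * (x : ℂ)))
        = φ x * (Real.cos (2 * π * ω₀ * x + π * τ) : ℂ) := by
  intro x
  set g : ℝ → ℂ := fun ξ => Φ ξ * Complex.exp (2 * (π : ℂ) * Complex.I * (ξ : ℂ) * (x : ℂ)) with hg
  have hgi : Integrable g := by
    refine hΦ.mul_bdd (c := 1) ?_ ?_
    · exact Continuous.aestronglyMeasurable (by fun_prop)
    · refine Filter.Eventually.of_forall fun ξ => ?_
      have : (2 * (π : ℂ) * Complex.I * (ξ : ℂ) * (x : ℂ)) = ((2 * π * ξ * x : ℝ) : ℂ) * Complex.I := by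
        push_cast; ring
      rw [this, Complex.norm_exp_ofReal_mul_I]
  set θ : ℂ := 2 * (π : ℂ) * (ω₀ : ℂ) * (x : ℂ) + (π : ℂ) * (τ : ℂ) with hθ
  have key : ∀ ω : ℝ, Complex.exp (Complex.I * (π : ℂ) * (τ : ℂ) * (Real.sign ω : ℂ)) *
          ((Φ (ω - ω₀) + Φ (ω + ω₀)) / 2) *
          Complex.exp (2 * (π : ℂ) * Complex.I * (ω : ℂ) * (x : ℂ))
      = Complex.exp (θ * Complex.I) / 2 * g (ω - ω₀)
        + Complex.exp (-θ * Complex.I) / 2 * g (ω + ω₀) := by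
    intro ω
    have hpos : 0 ≤ ω → Φ (ω + ω₀) = 0 := fun h => hsupp _ (by
      rw [abs_of_nonneg (by linarith)]; linarith)
    have hneg : ω ≤ 0 → Φ (ω - ω₀) = 0 := fun h => hsupp _ (by
      rw [abs_of_nonpos (by linarith)]; linarith)
    simp only [hg]
    rcases lt_trichotomy ω 0 with h | h | h
    · rw [hneg h.le, Real.sign_of_neg h]
      have e : Complex.exp (Complex.I * (π : ℂ) * (τ : ℂ) * ((-1 : ℝ) : ℂ)) *
          Complex.exp (2 * (π : ℂ) * Complex.I * (ω : ℂ) * (x : ℂ)) =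
          Complex.exp (-θ * Complex.I) *
          Complex.exp (2 * (π : ℂ) * Complex.I * ((ω + ω₀ : ℝ) : ℂ) * (x : ℂ)) := by
        rw [← Complex.exp_add, ← Complex.exp_add, hθ]
        congr 1; push_cast; ring
      linear_combination (Φ (ω + ω₀) / 2) * e
    · rw [hneg h.le, hpos h.ge]; simp
    · rw [hpos h.le, Real.sign_of_pos h]
      have e : Complex.exp (Complex.I * (π : ℂ) * (τ : ℂ) * ((1 : ℝ) : ℂ)) *
          Complex.exp (2 * (π : ℂ) * Complex.I * (ω : ℂ) * (x : ℂ)) =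
          Complex.exp (θ * Complex.I) *
          Complex.exp (2 * (π : ℂ) * Complex.I * ((ω - ω₀ : ℝ) : ℂ) * (x : ℂ)) := by
        rw [← Complex.exp_add, ← Complex.exp_add, hθ]
        congr 1; push_cast; ring
      linear_combination (Φ (ω - ω₀) / 2) * e
  rw [integral_congr_ae (Filter.Eventually.of_forall key),
    integral_add ((hgi.comp_sub_right ω₀).const_mul _) ((hgi.comp_add_right ω₀).const_mul _),
    integral_const_mul, integral_const_mul, integral_sub_right_eq_self g ω₀,
    integral_add_right_eq_self g ω₀, hφ x]
  have hc : ((Real.cos (2 * π * ω₀ * x + π * τ) : ℝ) : ℂ) = Complex.cos θ := by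
    rw [hθ]; push_cast; rfl
  rw [hc, Complex.cos]
  ring
end

section
/- Let Ω > 0, τ ∈ ℝ, let u be a unit vector in the Euclidean plane ℝ², and let Φ : ℝ² → ℂ be integrable with Φ(ω) = 0 whenever ‖ω‖ ≥ Ω. Define the window φ(x) = ∫_{ℝ²} Φ(ξ)·exp(2πi·⟪ξ, x⟫) dξ. Then for every x ∈ ℝ², ∫_{ℝ²} exp(iπτ·sgn⟪u, ω⟫)·((Φ(ω − Ω·u) + Φ(ω + Ω·u))/2)·exp(2πi·⟪ω, x⟫) dω = φ(x)·cos(2π·Ω·⟪u, x⟫ + πτ). (The fractional directional Hilbert transform along direction u of a windowed directional plane wave acts only on the phase of the oscillation while the window remains fixed: 𝓗_{u,τ}{φ(x)·cos(2πΩ·uᵀx)} = φ(x)·cos(2πΩ·uᵀx + πτ).) -/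
open MeasureTheory Real Complex
open scoped RealInnerProductSpace

theorem fdHT_windowed_plane_wave
    (Ω τ : ℝ) (hΩ : 0 < Ω)
    (u : EuclideanSpace ℝ (Fin 2)) (hu : ‖u‖ = 1)
    (Φ : EuclideanSpace ℝ (Fin 2) → ℂ) (hΦ : Integrable Φ)
    (hsupp : ∀ ω : EuclideanSpace ℝ (Fin 2), Ω ≤ ‖ω‖ → Φ ω = 0)
    (φ : EuclideanSpace ℝ (Fin 2) → ℂ)
    (hφ : ∀ x : EuclideanSpace ℝ (Fin 2),
      φ x = ∫ ξ : EuclideanSpace ℝ (Fin 2),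
        Φ ξ * Complex.exp (2 * (π : ℂ) * Complex.I * ((⟪ξ, x⟫ : ℝ) : ℂ))) :
    ∀ x : EuclideanSpace ℝ (Fin 2),
      (∫ ω : EuclideanSpace ℝ (Fin 2),
          Complex.exp (Complex.I * (π : ℂ) * (τ : ℂ) * ((Real.sign ⟪u, ω⟫ : ℝ) : ℂ)) *
            ((Φ (ω - Ω • u) + Φ (ω + Ω • u)) / 2) *
            Complex.exp (2 * (π : ℂ) * Complex.I * ((⟪ω, x⟫ : ℝ) : ℂ)))
        = φ x * (Real.cos (2 * π * Ω * ⟪u, x⟫ + π * τ) : ℂ) := by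
  intro x
  set g : EuclideanSpace ℝ (Fin 2) → ℂ := fun ξ =>
    Φ ξ * Complex.exp (2 * (π : ℂ) * Complex.I * ((⟪ξ, x⟫ : ℝ) : ℂ)) with hg
  set θ : ℝ := 2 * π * Ω * ⟪u, x⟫ + π * τ with hθ
  have hgi : Integrable g := by
    refine hΦ.mul_bdd (c := 1) ?_ ?_
    · exact Continuous.aestronglyMeasurable (by fun_prop)
    · refine Filter.Eventually.of_forall fun ξ => ?_
      rw [Complex.norm_exp]
      simp
  have key : ∀ ω : EuclideanSpace ℝ (Fin 2),
      Complex.exp (Complex.I * (π : ℂ) * (τ : ℂ) * ((Real.sign ⟪u, ω⟫ : ℝ) : ℂ)) *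
            ((Φ (ω - Ω • u) + Φ (ω + Ω • u)) / 2) *
            Complex.exp (2 * (π : ℂ) * Complex.I * ((⟪ω, x⟫ : ℝ) : ℂ))
      = Complex.exp (θ * Complex.I) / 2 * g (ω - Ω • u)
        + Complex.exp (-θ * Complex.I) / 2 * g (ω + Ω • u) := by
    intro ω
    have huu : ⟪u, u⟫ = 1 := by rw [real_inner_self_eq_norm_sq, hu]; norm_num
    have h1 : Φ (ω - Ω • u) *
          Complex.exp (Complex.I * (π : ℂ) * (τ : ℂ) * ((Real.sign ⟪u, ω⟫ : ℝ) : ℂ))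
        = Φ (ω - Ω • u) * Complex.exp (Complex.I * (π : ℂ) * (τ : ℂ)) := by
      by_cases hn : Ω ≤ ‖ω - Ω • u‖
      · simp [hsupp _ hn]
      · have hb := abs_real_inner_le_norm u (ω - Ω • u)
        rw [inner_sub_right, real_inner_smul_right, huu, hu] at hb
        have hp : 0 < ⟪u, ω⟫ := by
          have := (abs_le.1 hb).1
          linarith
        rw [Real.sign_of_pos hp]
        simp
    have h2 : Φ (ω + Ω • u) *
          Complex.exp (Complex.I * (π : ℂ) * (τ : ℂ) * ((Real.sign ⟪u, ω⟫ : ℝ) : ℂ))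
        = Φ (ω + Ω • u) * Complex.exp (-(Complex.I * (π : ℂ) * (τ : ℂ))) := by
      by_cases hn : Ω ≤ ‖ω + Ω • u‖
      · simp [hsupp _ hn]
      · have hb := abs_real_inner_le_norm u (ω + Ω • u)
        rw [inner_add_right, real_inner_smul_right, huu, hu] at hb
        have hp : ⟪u, ω⟫ < 0 := by
          have := (abs_le.1 hb).2
          linarith
        rw [Real.sign_of_neg hp]
        simp
    have e1 : Complex.exp (Complex.I * (π : ℂ) * (τ : ℂ)) *
          Complex.exp (2 * (π : ℂ) * Complex.I * ((⟪ω, x⟫ : ℝ) : ℂ))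
        = Complex.exp (θ * Complex.I) *
          Complex.exp (2 * (π : ℂ) * Complex.I * ((⟪ω - Ω • u, x⟫ : ℝ) : ℂ)) := by
      rw [← Complex.exp_add, ← Complex.exp_add, inner_sub_left, real_inner_smul_left, hθ]
      congr 1
      push_cast
      ring
    have e2 : Complex.exp (-(Complex.I * (π : ℂ) * (τ : ℂ))) *
          Complex.exp (2 * (π : ℂ) * Complex.I * ((⟪ω, x⟫ : ℝ) : ℂ))
        = Complex.exp (-θ * Complex.I) *
          Complex.exp (2 * (π : ℂ) * Complex.I * ((⟪ω + Ω • u, x⟫ : ℝ) : ℂ)) := by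
      rw [← Complex.exp_add, ← Complex.exp_add, inner_add_left, real_inner_smul_left, hθ]
      congr 1
      push_cast
      ring
    simp only [hg]
    linear_combination
      (Complex.exp (2 * (π : ℂ) * Complex.I * ((⟪ω, x⟫ : ℝ) : ℂ)) / 2) * (h1 + h2)
      + Φ (ω - Ω • u) / 2 * e1 + Φ (ω + Ω • u) / 2 * e2
  simp_rw [key]
  rw [integral_add ((hgi.comp_sub_right _).const_mul _) ((hgi.comp_add_right _).const_mul _),
    integral_const_mul, integral_const_mul, integral_sub_right_eq_self g,
    integral_add_right_eq_self g, hφ x, Complex.ofReal_cos, Complex.cos]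
  ring
end

section
/- For α, τ, τ̄ ∈ ℝ and ω ∈ (0, 2π), define B(α, τ, ω) = ((1 − exp(−i·ω))/(i·ω))^((α+1)/2 + τ) · ((1 − exp(i·ω))/(−i·ω))^((α+1)/2 − τ), all powers being principal-branch complex powers. Then B(α, τ, ω) = exp(−i·π·τ̄) · (1 − exp(−i·ω))^(τ̄) · (1 − exp(i·ω))^(−τ̄) · B(α, τ − τ̄, ω). (Fourier-domain form of Proposition 3: the fractional Hilbert transform of order τ̄ maps the fractional B-spline of degree α and shift τ to the fractional finite-difference filter of order τ̄ applied to the fractional B-spline of degree α and shift τ − τ̄.) -/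
open Real Complex

/-- Fourier transform of the fractional B-spline of degree `α` and shift `τ`. -/
noncomputable def Bspline (α τ ω : ℝ) : ℂ :=
  ((1 - Complex.exp (-Complex.I * (ω : ℂ))) / (Complex.I * (ω : ℂ))) ^
      (((α + 1) / 2 + τ : ℝ) : ℂ) *
  ((1 - Complex.exp (Complex.I * (ω : ℂ))) / (-Complex.I * (ω : ℂ))) ^
      (((α + 1) / 2 - τ : ℝ) : ℂ)

lemma polar_cpow (L θ : ℝ) (h1 : -π < θ) (h2 : θ ≤ π) (x : ℂ) :
    (Complex.exp (L + θ * Complex.I)) ^ x = Complex.exp ((L + θ * Complex.I) * x) := by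
  rw [Complex.cpow_def_of_ne_zero (Complex.exp_ne_zero _), Complex.log_exp (by simpa using h1) (by simpa using h2)]

lemma exp_half_pi_I : Complex.exp ((π : ℂ) / 2 * Complex.I) = Complex.I := by
  rw [Complex.exp_mul_I]; simp

lemma base_one (ω : ℝ) (h : 0 < Real.sin (ω / 2)) :
    1 - Complex.exp (-Complex.I * (ω : ℂ)) =
      Complex.exp ((Real.log (2 * Real.sin (ω / 2)) : ℝ) + ((π / 2 - ω / 2 : ℝ) : ℂ) * Complex.I) := by
  have e : (((π / 2 - ω / 2 : ℝ) : ℂ) * Complex.I)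
      = (π : ℂ) / 2 * Complex.I + -((ω : ℂ) / 2) * Complex.I := by push_cast; ring
  have e2 : -Complex.I * (ω : ℂ) = -((ω : ℂ) / 2) * Complex.I + -((ω : ℂ) / 2) * Complex.I := by ring
  rw [Complex.exp_add, e, Complex.exp_add, exp_half_pi_I, ← Complex.ofReal_exp,
    Real.exp_log (by positivity), e2, Complex.exp_add]
  push_cast
  rw [Complex.sin]
  have h1 : Complex.exp ((ω : ℂ) / 2 * Complex.I) * Complex.exp (-((ω : ℂ) / 2) * Complex.I) = 1 := by
    rw [← Complex.exp_add]; simp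
  linear_combination (-1 : ℂ) * h1 - (Complex.exp (-((ω : ℂ) / 2) * Complex.I) ^ 2
    - Complex.exp ((ω : ℂ) / 2 * Complex.I) * Complex.exp (-((ω : ℂ) / 2) * Complex.I))
      * Complex.I_sq

lemma base_two (ω : ℝ) (h : 0 < Real.sin (ω / 2)) :
    1 - Complex.exp (Complex.I * (ω : ℂ)) =
      Complex.exp ((Real.log (2 * Real.sin (ω / 2)) : ℝ) + ((ω / 2 - π / 2 : ℝ) : ℂ) * Complex.I) := by
  have := congrArg (starRingEnd ℂ) (base_one ω h)
  simp only [map_sub, map_one, ← Complex.exp_conj, map_mul, map_add, map_neg, Complex.conj_I,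
    Complex.conj_ofReal, neg_neg] at this
  rw [this]
  congr 1
  push_cast; ring

theorem fHT_Bspline_shift
    (α τ τ' : ℝ) (ω : ℝ) (hω : ω ∈ Set.Ioo (0 : ℝ) (2 * π)) :
    Bspline α τ ω
      = Complex.exp (-Complex.I * (π : ℂ) * (τ' : ℂ)) *
        (1 - Complex.exp (-Complex.I * (ω : ℂ))) ^ ((τ' : ℂ)) *
        (1 - Complex.exp (Complex.I * (ω : ℂ))) ^ (-(τ' : ℂ)) *
        Bspline α (τ - τ') ω := by
  obtain ⟨h0, h2⟩ := hω
  have hp := Real.pi_pos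
  have hs : 0 < Real.sin (ω / 2) := Real.sin_pos_of_pos_of_lt_pi (by linarith) (by linarith)
  have hw : (ω : ℂ) = Complex.exp ((Real.log ω : ℝ)) := by
    rw [← Complex.ofReal_exp, Real.exp_log h0]
  have d1 : Complex.I * (ω : ℂ) = Complex.exp ((Real.log ω : ℝ) + (π : ℂ) / 2 * Complex.I) := by
    rw [Complex.exp_add, exp_half_pi_I, ← hw, mul_comm]
  have d2 : -Complex.I * (ω : ℂ) = Complex.exp ((Real.log ω : ℝ) - (π : ℂ) / 2 * Complex.I) := by
    rw [Complex.exp_sub, exp_half_pi_I, ← hw, Complex.div_I]; ring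
  have q1 : (1 - Complex.exp (-Complex.I * (ω : ℂ))) / (Complex.I * (ω : ℂ)) =
      Complex.exp ((Real.log (2 * Real.sin (ω / 2)) - Real.log ω : ℝ)
        + ((-(ω / 2) : ℝ) : ℂ) * Complex.I) := by
    rw [base_one ω hs, d1, ← Complex.exp_sub]; congr 1; push_cast; ring
  have q2 : (1 - Complex.exp (Complex.I * (ω : ℂ))) / (-Complex.I * (ω : ℂ)) =
      Complex.exp ((Real.log (2 * Real.sin (ω / 2)) - Real.log ω : ℝ)
        + ((ω / 2 : ℝ) : ℂ) * Complex.I) := by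
    rw [base_two ω hs, d2, ← Complex.exp_sub]; congr 1; push_cast; ring
  unfold Bspline
  rw [q1, q2, base_one ω hs, base_two ω hs]
  rw [polar_cpow _ _ (by linarith) (by linarith), polar_cpow _ _ (by linarith) (by linarith),
    polar_cpow _ _ (by linarith) (by linarith), polar_cpow _ _ (by linarith) (by linarith),
    polar_cpow _ _ (by linarith) (by linarith), polar_cpow _ _ (by linarith) (by linarith)]
  simp only [← Complex.exp_add]
  congr 1
  push_cast
  ring
end
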